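/- 𝓑 is the least supersolution: 𝓑 is itself a supersolution, and for every supersolution B one has 𝓑(x) ≤ B(x) for all x ∈ ℝ. -/

import Mathlib

open MeasureTheory

noncomputable section

/-- The dyadic subinterval `[k/2^n, (k+1)/2^n]` of `[0,1]`. -/
def dyadicI (n k : ℕ) : Set ℝ := Set.Icc ((k : ℝ) / 2 ^ n) (((k : ℝ) + 1) / 2 ^ n)

/-- The Haar function of the dyadic interval `[k/2^n, (k+1)/2^n]`: it equals `-1` on the
left half of the interval, `+1` on its right half and `0` elsewhere. -/
def haar (n k : ℕ) (x : ℝ) : ℝ :=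
  if x ∈ Set.Ico ((k : ℝ) / 2 ^ n) ((2 * (k : ℝ) + 1) / 2 ^ (n + 1)) then -1
  else if x ∈ Set.Ico ((2 * (k : ℝ) + 1) / 2 ^ (n + 1)) (((k : ℝ) + 1) / 2 ^ n) then 1
  else 0

/-- The Haar coefficient `a_J = μ(J)⁻¹ ∫_I f h_J` of `f` at `J = [k/2^n, (k+1)/2^n]`. -/
def haarCoeff (f : ℝ → ℝ) (n k : ℕ) : ℝ :=
  2 ^ n * ∫ x in Set.Icc (0 : ℝ) 1, f x * haar n k x

/-- The dyadic square function `Sf = √(Σ_J a_J² χ_J)`. -/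
def sqFn (f : ℝ → ℝ) (x : ℝ) : ℝ :=
  Real.sqrt (∑' p : ℕ × ℕ, (haarCoeff f p.1 p.2) ^ 2 * (dyadicI p.1 p.2).indicator 1 x)

/-- A test function for the Bellman function: integrable on `I = [0,1]`, with zero mean
and with dyadic square function essentially bounded by `1` on `I`. -/
def Admissible (f : ℝ → ℝ) : Prop :=
  IntegrableOn f (Set.Icc 0 1) ∧ (∫ x in Set.Icc (0 : ℝ) 1, f x) = 0 ∧
    ∀ᵐ x ∂(volume.restrict (Set.Icc (0 : ℝ) 1)), sqFn f x ≤ 1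

/-- The Bellman function `𝓑(x) = sup{ μ{f ≥ x} : ∫_I f = 0, ‖Sf‖_∞ ≤ 1 }`. -/
def bellman (x : ℝ) : ℝ :=
  sSup { m : ℝ | ∃ f : ℝ → ℝ, Admissible f ∧
    m = (volume { y ∈ Set.Icc (0 : ℝ) 1 | x ≤ f y }).toReal }

/-- `X(x,τ) = (x+τ)/√(1-τ²)`. -/
def XX (x t : ℝ) : ℝ := (x + t) / Real.sqrt (1 - t ^ 2)

/-- A supersolution: a continuous, nonnegative, nonincreasing function which equals `1`
on the negative semiaxis and satisfies the Bellman inequality. -/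
def Supersolution (B : ℝ → ℝ) : Prop :=
  Continuous B ∧ (∀ x, 0 ≤ B x) ∧ Antitone B ∧ (∀ x : ℝ, x ≤ 0 → B x = 1) ∧
    ∀ x : ℝ, ∀ τ ∈ Set.Ioo (-1 : ℝ) 1, (B (XX x (-τ)) + B (XX x τ)) / 2 ≤ B x

open Filter Topology Set

/-- The half-difference of a dyadic array across the two children of the `k`-th interval of
generation `n`. -/
def halfDiff (A : ℕ → ℕ → ℝ) (n k : ℕ) : ℝ := (A (n + 1) (2 * k + 1) - A (n + 1) (2 * k)) / 2

/-- The sum of the squared half-differences over the strict ancestors of the `k`-th interval of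
generation `n`. -/
def ancestorSq (A : ℕ → ℕ → ℝ) : ℕ → ℕ → ℝ
  | 0, _ => 0
  | n + 1, k => ancestorSq A n (k / 2) + halfDiff A n (k / 2) ^ 2

/-- A dyadic martingale: each value is the mean of the values at the two children. -/
def DyadicMartingale (A : ℕ → ℕ → ℝ) : Prop :=
  ∀ n k, k < 2 ^ n → A n k = (A (n + 1) (2 * k) + A (n + 1) (2 * k + 1)) / 2

lemma ancestorSq_nonneg (A : ℕ → ℕ → ℝ) (n k : ℕ) : 0 ≤ ancestorSq A n k := by
  induction n generalizing k with
  | zero => simp [ancestorSq]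
  | succ n ih => exact add_nonneg (ih _) (sq_nonneg _)

lemma ancestorSq_left (A : ℕ → ℕ → ℝ) (n k : ℕ) :
    ancestorSq A (n + 1) (2 * k) = ancestorSq A n k + halfDiff A n k ^ 2 := by
  simp [ancestorSq]

lemma ancestorSq_right (A : ℕ → ℕ → ℝ) (n k : ℕ) :
    ancestorSq A (n + 1) (2 * k + 1) = ancestorSq A n k + halfDiff A n k ^ 2 := by
  have h : (2 * k + 1) / 2 = k := by omega
  simp [ancestorSq, h]

lemma DyadicMartingale.left {A : ℕ → ℕ → ℝ} (hA : DyadicMartingale A) {n k : ℕ}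
    (hk : k < 2 ^ n) : A (n + 1) (2 * k) = A n k - halfDiff A n k := by
  rw [hA n k hk, halfDiff]; ring

lemma DyadicMartingale.right {A : ℕ → ℕ → ℝ} (hA : DyadicMartingale A) {n k : ℕ}
    (hk : k < 2 ^ n) : A (n + 1) (2 * k + 1) = A n k + halfDiff A n k := by
  rw [hA n k hk, halfDiff]; ring

lemma sum_range_two_mul (g : ℕ → ℝ) (m : ℕ) :
    ∑ k ∈ Finset.range (2 * m), g k = ∑ k ∈ Finset.range m, (g (2 * k) + g (2 * k + 1)) := by
  induction m with
  | zero => simp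
  | succ m ih =>
    rw [show 2 * (m + 1) = 2 * m + 1 + 1 by ring, Finset.sum_range_succ, Finset.sum_range_succ,
      ih, Finset.sum_range_succ]
    ring

lemma sum_range_two_pow_succ (g : ℕ → ℝ) (n : ℕ) :
    ∑ k ∈ Finset.range (2 ^ (n + 1)), g k =
      ∑ k ∈ Finset.range (2 ^ n), (g (2 * k) + g (2 * k + 1)) := by
  rw [pow_succ', sum_range_two_mul]

lemma XX_rescale {y s d : ℝ} (hsd : s + d ^ 2 < 1) :
    d / √(1 - s) ∈ Ioo (-1 : ℝ) 1 ∧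
      XX (y / √(1 - s)) (d / √(1 - s)) = (y + d) / √(1 - (s + d ^ 2)) := by
  have h1 : 0 < 1 - s := by nlinarith [sq_nonneg d]
  have h2 : 0 < √(1 - s) := Real.sqrt_pos.2 h1
  have hsq : √(1 - s) ^ 2 = 1 - s := Real.sq_sqrt h1.le
  have habs : |d| < √(1 - s) := by
    rw [← Real.sqrt_sq_eq_abs]
    exact Real.sqrt_lt_sqrt (sq_nonneg d) (by linarith)
  refine ⟨?_, ?_⟩
  · rw [mem_Ioo, ← abs_lt, abs_div, abs_of_pos h2, div_lt_one h2]
    exact habs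
  · have h3 : 1 - (d / √(1 - s)) ^ 2 = (1 - (s + d ^ 2)) / (1 - s) := by
      rw [div_pow, hsq]; field_simp; ring
    rw [XX, h3, Real.sqrt_div (by linarith), ← add_div, div_div_div_cancel_right₀ h2.ne']

lemma Supersolution.sum_le {B : ℝ → ℝ} (hB : Supersolution B) {A : ℕ → ℕ → ℝ}
    (hA : DyadicMartingale A) (hS : ∀ n k, k < 2 ^ n → ancestorSq A n k < 1) (x : ℝ) (n : ℕ) :
    ∑ k ∈ Finset.range (2 ^ n), B ((x - A n k) / √(1 - ancestorSq A n k)) ≤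
      2 ^ n * B (x - A 0 0) := by
  induction n with
  | zero => simp [ancestorSq]
  | succ n ih =>
    rw [sum_range_two_pow_succ, pow_succ', mul_assoc]
    refine le_trans ?_ (mul_le_mul_of_nonneg_left ih (by norm_num))
    rw [Finset.mul_sum]
    refine Finset.sum_le_sum fun k hk => ?_
    have hk : k < 2 ^ n := Finset.mem_range.1 hk
    have h := hS (n + 1) (2 * k) (by rw [pow_succ']; omega)
    rw [ancestorSq_left] at h
    obtain ⟨hτ, e₁⟩ := XX_rescale (y := x - A n k) h
    obtain ⟨-, e₂⟩ := XX_rescale (y := x - A n k) (d := -halfDiff A n k)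
      (by simpa using h)
    have key := hB.2.2.2.2 ((x - A n k) / √(1 - ancestorSq A n k)) _ hτ
    rw [e₁, ← neg_div, e₂, neg_sq] at key
    rw [ancestorSq_left, ancestorSq_right, hA.left hk, hA.right hk, ← sub_add,
      ← sub_sub x]
    simp only [← sub_eq_add_neg] at key
    linarith

/-- The Huber function with threshold `K`: quadratic on `[-K, K]` and affine outside. -/
def huber (K y : ℝ) : ℝ := 2 * max (-K) (min K y) * y - max (-K) (min K y) ^ 2

lemma huber_of_abs_le {K y : ℝ} (h : |y| ≤ K) : huber K y = y ^ 2 := by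
  obtain ⟨h1, h2⟩ := abs_le.1 h
  rw [huber, min_eq_right h2, max_eq_right h1]; ring

lemma abs_clamp_le {K : ℝ} (hK : 0 ≤ K) (y : ℝ) : |max (-K) (min K y)| ≤ K :=
  abs_le.2 ⟨le_max_left _ _, max_le (by linarith) (min_le_left _ _)⟩

lemma le_huber {K s : ℝ} (hs : |s| ≤ K) (y : ℝ) : 2 * s * y - s ^ 2 ≤ huber K y := by
  obtain ⟨h1, h2⟩ := abs_le.1 hs
  rw [huber]
  rcases le_total K y with h | h
  · rw [min_eq_left h, max_eq_right (by linarith)]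
    nlinarith
  · rw [min_eq_right h]
    rcases le_total (-K) y with h' | h'
    · rw [max_eq_right h']; nlinarith [sq_nonneg (y - s)]
    · rw [max_eq_left h']; nlinarith

lemma huber_nonneg {K : ℝ} (hK : 0 ≤ K) (y : ℝ) : 0 ≤ huber K y := by
  simpa using le_huber (K := K) (s := 0) (by simpa using hK) y

lemma huber_le {K : ℝ} (hK : 0 ≤ K) (y : ℝ) : huber K y ≤ 2 * K * |y| := by
  have h1 := abs_clamp_le hK y
  have h2 : max (-K) (min K y) * y ≤ K * |y| :=
    (le_abs_self _).trans ((abs_mul _ _).le.trans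
      (mul_le_mul_of_nonneg_right h1 (abs_nonneg _)))
  rw [huber]
  nlinarith [sq_nonneg (max (-K) (min K y))]

lemma huber_midpoint {K : ℝ} (hK : 0 ≤ K) (y d : ℝ) :
    2 * huber K y ≤ huber K (y - d) + huber K (y + d) := by
  have h1 := le_huber (abs_clamp_le hK y) (y - d)
  have h2 := le_huber (abs_clamp_le hK y) (y + d)
  rw [huber]
  linarith

/-- The square of the half-difference, cut off where it or the martingale is large. -/
def truncSq (A : ℕ → ℕ → ℝ) (M : ℝ) (n k : ℕ) : ℝ :=
  if |A n k| ≤ M ∧ |halfDiff A n k| ≤ 2 * M then halfDiff A n k ^ 2 else 0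

lemma truncSq_nonneg (A : ℕ → ℕ → ℝ) (M : ℝ) (n k : ℕ) : 0 ≤ truncSq A M n k := by
  rw [truncSq]; split_ifs <;> positivity

lemma huber_add_truncSq_le {A : ℕ → ℕ → ℝ} (hA : DyadicMartingale A) {M : ℝ} (hM : 0 ≤ M)
    {n k : ℕ} (hk : k < 2 ^ n) :
    2 * (huber (3 * M) (A n k) + truncSq A M n k) ≤
      huber (3 * M) (A (n + 1) (2 * k)) + huber (3 * M) (A (n + 1) (2 * k + 1)) := by
  rw [hA.left hk, hA.right hk, truncSq]
  split_ifs with h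
  · obtain ⟨h1, h2⟩ := h
    rw [huber_of_abs_le (by linarith), huber_of_abs_le, huber_of_abs_le]
    · linarith
    · exact (abs_add_le _ _).trans (by linarith)
    · exact (abs_sub _ _).trans (by linarith)
  · rw [add_zero]; exact huber_midpoint (by linarith) _ _

lemma sum_truncSq_le {A : ℕ → ℕ → ℝ} (hA : DyadicMartingale A) {M : ℝ} (hM : 0 ≤ M) (N : ℕ) :
    ∑ n ∈ Finset.range N, (2 ^ n : ℝ)⁻¹ * ∑ k ∈ Finset.range (2 ^ n), truncSq A M n k ≤
      (2 ^ N : ℝ)⁻¹ * ∑ k ∈ Finset.range (2 ^ N), huber (3 * M) (A N k) := by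
  induction N with
  | zero => simpa using huber_nonneg (by linarith) _
  | succ N ih =>
    rw [Finset.sum_range_succ]
    refine (add_le_add_left ih _).trans ?_
    rw [← mul_add, ← Finset.sum_add_distrib, sum_range_two_pow_succ, pow_succ', mul_inv,
      mul_comm (2 : ℝ)⁻¹, mul_assoc]
    refine mul_le_mul_of_nonneg_left ?_ (by positivity)
    rw [Finset.mul_sum]
    refine Finset.sum_le_sum fun k hk => ?_
    have := huber_add_truncSq_le hA hM (Finset.mem_range.1 hk)
    linarith

/-- The mean value of `f` over `[k/2^n, (k+1)/2^n]`. -/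
def dyadicAvg (f : ℝ → ℝ) (n k : ℕ) : ℝ :=
  2 ^ n * ∫ x in ((k : ℝ) / 2 ^ n)..(((k : ℝ) + 1) / 2 ^ n), f x

/-- The index of the dyadic interval of generation `n` containing `t`. -/
def dyadicIdx (n : ℕ) (t : ℝ) : ℕ := ⌊2 ^ n * t⌋₊

lemma dyadicIdx_eq_iff {n k : ℕ} {t : ℝ} (ht : 0 ≤ t) :
    dyadicIdx n t = k ↔ t ∈ Ico ((k : ℝ) / 2 ^ n) (((k : ℝ) + 1) / 2 ^ n) := by
  have h : (0 : ℝ) < 2 ^ n := by positivity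
  rw [dyadicIdx, Nat.floor_eq_iff (by positivity), mem_Ico, div_le_iff₀ h, lt_div_iff₀ h,
    mul_comm t]

lemma dyadicIdx_lt {n : ℕ} {t : ℝ} (ht : t ∈ Ico (0 : ℝ) 1) : dyadicIdx n t < 2 ^ n := by
  have h : (0 : ℝ) < 2 ^ n := by positivity
  rw [dyadicIdx, Nat.floor_lt (mul_nonneg h.le ht.1)]
  push_cast
  nlinarith [ht.2]

lemma dyadicIdx_mem {n : ℕ} {t : ℝ} (ht : 0 ≤ t) :
    t ∈ Ico ((dyadicIdx n t : ℝ) / 2 ^ n) (((dyadicIdx n t : ℝ) + 1) / 2 ^ n) :=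
  (dyadicIdx_eq_iff ht).1 rfl

lemma dyadicIdx_succ_div_two (n : ℕ) (t : ℝ) : dyadicIdx (n + 1) t / 2 = dyadicIdx n t := by
  have h := Nat.floor_div_natCast ((2 : ℝ) ^ (n + 1) * t) 2
  rw [dyadicIdx, dyadicIdx, ← h, pow_succ]
  congr 1
  push_cast
  ring

lemma ancestorSq_dyadicIdx (A : ℕ → ℕ → ℝ) (n : ℕ) (t : ℝ) :
    ancestorSq A n (dyadicIdx n t) =
      ∑ m ∈ Finset.range n, halfDiff A m (dyadicIdx m t) ^ 2 := by
  induction n with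
  | zero => simp [ancestorSq]
  | succ n ih =>
    rw [Finset.sum_range_succ, ← ih, ancestorSq, dyadicIdx_succ_div_two]

lemma dyadic_left_nonneg (n k : ℕ) : (0 : ℝ) ≤ (k : ℝ) / 2 ^ n := by positivity

lemma dyadic_lt (n k : ℕ) : (k : ℝ) / 2 ^ n < ((k : ℝ) + 1) / 2 ^ n := by
  gcongr; linarith

lemma dyadic_right_le_one {n k : ℕ} (hk : k < 2 ^ n) : ((k : ℝ) + 1) / 2 ^ n ≤ 1 := by
  rw [div_le_one (by positivity)]
  exact_mod_cast hk

lemma dyadic_lt_mid (n k : ℕ) : (k : ℝ) / 2 ^ n < (2 * (k : ℝ) + 1) / 2 ^ (n + 1) := by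
  rw [pow_succ, div_lt_div_iff₀ (by positivity) (by positivity)]
  nlinarith [pow_pos (two_pos (α := ℝ)) n]

lemma dyadic_mid_lt (n k : ℕ) : (2 * (k : ℝ) + 1) / 2 ^ (n + 1) < ((k : ℝ) + 1) / 2 ^ n := by
  rw [pow_succ, div_lt_div_iff₀ (by positivity) (by positivity)]
  nlinarith [pow_pos (two_pos (α := ℝ)) n]

lemma dyadicAvg_left (f : ℝ → ℝ) (n k : ℕ) : dyadicAvg f (n + 1) (2 * k) =
    2 ^ (n + 1) * ∫ x in ((k : ℝ) / 2 ^ n)..((2 * (k : ℝ) + 1) / 2 ^ (n + 1)), f x := by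
  have h : (2 * (k : ℝ)) / 2 ^ (n + 1) = k / 2 ^ n := by rw [pow_succ]; field_simp
  rw [dyadicAvg]; push_cast; rw [h]

lemma dyadicAvg_right (f : ℝ → ℝ) (n k : ℕ) : dyadicAvg f (n + 1) (2 * k + 1) =
    2 ^ (n + 1) * ∫ x in ((2 * (k : ℝ) + 1) / 2 ^ (n + 1))..(((k : ℝ) + 1) / 2 ^ n), f x := by
  have h : (2 * (k : ℝ) + 1 + 1) / 2 ^ (n + 1) = (k + 1) / 2 ^ n := by
    rw [pow_succ]; field_simp; ring
  rw [dyadicAvg]; push_cast; rw [h]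

lemma intervalIntegrable_of_Icc {f : ℝ → ℝ} (hf : IntegrableOn f (Icc 0 1)) {a b : ℝ}
    (ha : 0 ≤ a) (hab : a ≤ b) (hb : b ≤ 1) : IntervalIntegrable f volume a b :=
  (intervalIntegrable_iff_integrableOn_Icc_of_le hab).2 (hf.mono_set (Icc_subset_Icc ha hb))

lemma dyadicMartingale_dyadicAvg {f : ℝ → ℝ} (hf : IntegrableOn f (Icc 0 1)) :
    DyadicMartingale (dyadicAvg f) := by
  intro n k hk
  have h1 := dyadic_lt_mid n k
  have h2 := dyadic_mid_lt n k
  have h0 := dyadic_left_nonneg n k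
  have h3 := dyadic_right_le_one hk
  rw [dyadicAvg_left, dyadicAvg_right, dyadicAvg,
    ← intervalIntegral.integral_add_adjacent_intervals
      (intervalIntegrable_of_Icc hf h0 h1.le (by linarith))
      (intervalIntegrable_of_Icc hf (by linarith) h2.le h3), pow_succ]
  ring

lemma dyadicAvg_zero (f : ℝ → ℝ) : dyadicAvg f 0 0 = ∫ x in Icc (0 : ℝ) 1, f x := by
  rw [dyadicAvg, integral_Icc_eq_integral_Ioc, ← intervalIntegral.integral_of_le zero_le_one]
  simp

lemma haar_eq (n k : ℕ) (f : ℝ → ℝ) (x : ℝ) : f x * haar n k x =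
    (Ico ((2 * (k : ℝ) + 1) / 2 ^ (n + 1)) (((k : ℝ) + 1) / 2 ^ n)).indicator f x -
      (Ico ((k : ℝ) / 2 ^ n) ((2 * (k : ℝ) + 1) / 2 ^ (n + 1))).indicator f x := by
  rw [haar]
  split_ifs with h1 h2
  · have h2 : x ∉ Ico ((2 * (k : ℝ) + 1) / 2 ^ (n + 1)) (((k : ℝ) + 1) / 2 ^ n) :=
      fun h => absurd h.1 (not_le.2 h1.2)
    rw [indicator_of_mem h1, indicator_of_notMem h2]; ring
  · rw [indicator_of_notMem h1, indicator_of_mem h2]; ring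
  · rw [indicator_of_notMem h1, indicator_of_notMem h2]; ring

lemma setIntegral_indicator_Ico {f : ℝ → ℝ} {a b : ℝ} (ha : 0 ≤ a) (hab : a ≤ b) (hb : b ≤ 1) :
    ∫ x in Icc (0 : ℝ) 1, (Ico a b).indicator f x = ∫ x in a..b, f x := by
  rw [setIntegral_indicator measurableSet_Ico, inter_eq_self_of_subset_right
    (Ico_subset_Icc_self.trans (Icc_subset_Icc ha hb)), integral_Ico_eq_integral_Ioc,
    intervalIntegral.integral_of_le hab]

lemma haarCoeff_eq_halfDiff {f : ℝ → ℝ} (hf : IntegrableOn f (Icc 0 1)) {n k : ℕ}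
    (hk : k < 2 ^ n) : haarCoeff f n k = halfDiff (dyadicAvg f) n k := by
  have h1 := dyadic_lt_mid n k
  have h2 := dyadic_mid_lt n k
  have h0 := dyadic_left_nonneg n k
  have h3 := dyadic_right_le_one hk
  rw [haarCoeff, halfDiff, dyadicAvg_left, dyadicAvg_right]
  simp_rw [haar_eq]
  rw [integral_sub (Integrable.indicator hf measurableSet_Ico)
    (Integrable.indicator hf measurableSet_Ico),
    setIntegral_indicator_Ico (by linarith) h2.le h3,
    setIntegral_indicator_Ico h0 h1.le (by linarith), pow_succ]
  ring

lemma iUnion_dyadic (n : ℕ) :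
    ⋃ k ∈ Finset.range (2 ^ n), Ico ((k : ℝ) / 2 ^ n) (((k : ℝ) + 1) / 2 ^ n) =
      Ico (0 : ℝ) 1 := by
  ext t
  simp only [mem_iUnion, exists_prop, Finset.mem_range]
  constructor
  · rintro ⟨k, hk, h1, h2⟩
    exact ⟨(dyadic_left_nonneg n k).trans h1, h2.trans_le (dyadic_right_le_one hk)⟩
  · intro ht
    exact ⟨_, dyadicIdx_lt ht, dyadicIdx_mem ht.1⟩

lemma pairwiseDisjoint_dyadic (n : ℕ) (s : Set ℕ) :
    s.PairwiseDisjoint fun k : ℕ => Ico ((k : ℝ) / 2 ^ n) (((k : ℝ) + 1) / 2 ^ n) := by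
  intro i _ j _ hij
  refine disjoint_left.2 fun t hi hj => hij ?_
  have ht : 0 ≤ t := (dyadic_left_nonneg n i).trans hi.1
  rw [← (dyadicIdx_eq_iff ht).2 hi, ← (dyadicIdx_eq_iff ht).2 hj]

lemma measurable_dyadicIdx (n : ℕ) : Measurable (dyadicIdx n) :=
  Nat.measurable_floor.comp (measurable_const.mul measurable_id)

lemma lintegral_dyadicIdx (n : ℕ) (F : ℕ → ENNReal) :
    ∫⁻ t in Ico (0 : ℝ) 1, F (dyadicIdx n t) =
      ENNReal.ofReal (2 ^ n : ℝ)⁻¹ * ∑ k ∈ Finset.range (2 ^ n), F k := by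
  rw [← iUnion_dyadic n, lintegral_biUnion_finset (pairwiseDisjoint_dyadic n _)
    (fun _ _ => measurableSet_Ico), Finset.mul_sum]
  refine Finset.sum_congr rfl fun k _ => ?_
  rw [setLIntegral_congr_fun (g := fun _ => F k) measurableSet_Ico, setLIntegral_const,
    Real.volume_Ico, mul_comm]
  · congr 2; field_simp; ring
  · intro t ht
    exact congrArg F ((dyadicIdx_eq_iff ((dyadic_left_nonneg n k).trans ht.1)).2 ht)

lemma sum_abs_dyadicAvg_le {f : ℝ → ℝ} (hf : IntegrableOn f (Icc 0 1)) (n : ℕ) :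
    (2 ^ n : ℝ)⁻¹ * ∑ k ∈ Finset.range (2 ^ n), |dyadicAvg f n k| ≤
      ∫ x in Icc (0 : ℝ) 1, |f x| := by
  have hf' : IntegrableOn (fun x => |f x|) (Ico 0 1) := (hf.mono_set Ico_subset_Icc_self).abs
  rw [integral_Icc_eq_integral_Ico, ← iUnion_dyadic n, integral_biUnion_finset _
    (fun _ _ => measurableSet_Ico) (pairwiseDisjoint_dyadic n _), Finset.mul_sum]
  · refine Finset.sum_le_sum fun k _ => ?_
    rw [dyadicAvg, abs_mul, abs_of_pos (by positivity), inv_mul_cancel_left₀ (by positivity),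
      integral_Ico_eq_integral_Ioc, ← intervalIntegral.integral_of_le (dyadic_lt n k).le]
    exact intervalIntegral.abs_integral_le_integral_abs (dyadic_lt n k).le
  · intro k hk
    refine hf'.mono_set ?_
    rw [← iUnion_dyadic n]
    exact subset_biUnion_of_mem (u := fun k : ℕ => Ico ((k : ℝ) / 2 ^ n) (((k : ℝ) + 1) / 2 ^ n)) hk

lemma ae_tendsto_dyadicAvg {f : ℝ → ℝ} (hf : IntegrableOn f (Icc 0 1)) :
    ∀ᵐ t ∂volume.restrict (Ico (0 : ℝ) 1),
      Tendsto (fun n => dyadicAvg f n (dyadicIdx n t)) atTop (𝓝 (f t)) := by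
  have hg : LocallyIntegrable ((Icc (0 : ℝ) 1).indicator f) :=
    ((integrable_indicator_iff measurableSet_Icc).2 hf).locallyIntegrable
  rw [ae_restrict_iff' measurableSet_Ico]
  filter_upwards [IsUnifLocDoublingMeasure.ae_tendsto_average volume hg 1] with t h ht
  have hδ : Tendsto (fun n : ℕ => (1 / 2 : ℝ) / 2 ^ n) atTop (𝓝[>] 0) := by
    refine tendsto_nhdsWithin_iff.2 ⟨?_, Eventually.of_forall fun n => ?_⟩
    · simpa [div_eq_mul_inv] using
        (tendsto_pow_atTop_nhds_zero_of_lt_one (r := (2 : ℝ)⁻¹) (by norm_num)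
          (by norm_num)).const_mul (1 / 2 : ℝ)
    · simp only [mem_Ioi]; positivity
  have hball (n : ℕ) : Metric.closedBall (((dyadicIdx n t : ℝ) + 1 / 2) / 2 ^ n)
      ((1 / 2 : ℝ) / 2 ^ n) =
      Icc ((dyadicIdx n t : ℝ) / 2 ^ n) (((dyadicIdx n t : ℝ) + 1) / 2 ^ n) := by
    rw [Real.closedBall_eq_Icc]; congr 1 <;> ring
  have key := h (fun n => ((dyadicIdx n t : ℝ) + 1 / 2) / 2 ^ n) _ hδ
    (Eventually.of_forall fun n => by
      rw [one_mul, hball]; exact Ico_subset_Icc_self (dyadicIdx_mem ht.1))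
  rw [indicator_of_mem (Ico_subset_Icc_self ht)] at key
  refine key.congr fun n => ?_
  rw [hball, setAverage_eq, Real.volume_real_Icc_of_le (dyadic_lt _ _).le, dyadicAvg,
    intervalIntegral.integral_of_le (dyadic_lt _ _).le, ← integral_Icc_eq_integral_Ioc,
    setIntegral_indicator measurableSet_Icc, inter_eq_self_of_subset_left
    (Icc_subset_Icc (dyadic_left_nonneg _ _) (dyadic_right_le_one (dyadicIdx_lt ht))),
    ← sub_div, add_sub_cancel_left, one_div, inv_inv, smul_eq_mul]

lemma ae_tsum_truncSq_lt_top {f : ℝ → ℝ} (hf : IntegrableOn f (Icc 0 1)) {M : ℝ} (hM : 0 ≤ M) :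
    ∀ᵐ t ∂volume.restrict (Ico (0 : ℝ) 1),
      ∑' n, ENNReal.ofReal (truncSq (dyadicAvg f) M n (dyadicIdx n t)) < ⊤ := by
  have hmeas (n : ℕ) : Measurable fun t : ℝ =>
      ENNReal.ofReal (truncSq (dyadicAvg f) M n (dyadicIdx n t)) :=
    (measurable_from_nat (f := fun k => ENNReal.ofReal (truncSq (dyadicAvg f) M n k))).comp
      (measurable_dyadicIdx n)
  refine ae_lt_top (Measurable.tsum hmeas) (ne_top_of_le_ne_top
    (ENNReal.ofReal_ne_top (r := 2 * (3 * M) * ∫ x in Icc (0 : ℝ) 1, |f x|)) ?_)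
  rw [lintegral_tsum fun n => (hmeas n).aemeasurable]
  refine ENNReal.tsum_le_of_sum_range_le fun N => ?_
  have hterm (n : ℕ) : ∫⁻ t in Ico (0 : ℝ) 1,
      ENNReal.ofReal (truncSq (dyadicAvg f) M n (dyadicIdx n t)) =
      ENNReal.ofReal ((2 ^ n : ℝ)⁻¹ *
        ∑ k ∈ Finset.range (2 ^ n), truncSq (dyadicAvg f) M n k) := by
    rw [lintegral_dyadicIdx n fun k => ENNReal.ofReal (truncSq (dyadicAvg f) M n k),
      ENNReal.ofReal_mul (by positivity),
      ENNReal.ofReal_sum_of_nonneg fun k _ => truncSq_nonneg _ _ _ _]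
  simp_rw [hterm]
  rw [← ENNReal.ofReal_sum_of_nonneg fun n _ => mul_nonneg (by positivity)
    (Finset.sum_nonneg fun k _ => truncSq_nonneg _ _ _ _)]
  refine ENNReal.ofReal_le_ofReal ((sum_truncSq_le (dyadicMartingale_dyadicAvg hf) hM N).trans ?_)
  refine le_trans ?_ (mul_le_mul_of_nonneg_left (sum_abs_dyadicAvg_le hf N)
    (by positivity : 0 ≤ 2 * (3 * M)))
  rw [mul_left_comm]
  refine mul_le_mul_of_nonneg_left ?_ (by positivity)
  rw [Finset.mul_sum]
  exact Finset.sum_le_sum fun k _ => huber_le (by positivity) _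

/-- The dyadic square function of an integrable function is finite almost everywhere. -/
lemma ae_summable_halfDiff_sq {f : ℝ → ℝ} (hf : IntegrableOn f (Icc 0 1)) :
    ∀ᵐ t ∂volume.restrict (Ico (0 : ℝ) 1),
      Summable fun n => halfDiff (dyadicAvg f) n (dyadicIdx n t) ^ 2 := by
  have hA := dyadicMartingale_dyadicAvg hf
  filter_upwards [ae_tendsto_dyadicAvg hf, ae_restrict_mem measurableSet_Ico,
    ae_all_iff.2 fun M : ℕ => ae_tsum_truncSq_lt_top hf (Nat.cast_nonneg (α := ℝ) M)]
    with t hlim ht hfin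
  obtain ⟨C, hC⟩ := hlim.norm.bddAbove_range
  obtain ⟨M, hM⟩ := exists_nat_ge C
  have hbd (n : ℕ) : |dyadicAvg f n (dyadicIdx n t)| ≤ M :=
    (hC (mem_range_self n)).trans hM
  have htrunc (n : ℕ) : truncSq (dyadicAvg f) M n (dyadicIdx n t) =
      halfDiff (dyadicAvg f) n (dyadicIdx n t) ^ 2 := by
    refine if_pos ⟨hbd n, ?_⟩
    have h1 := abs_le.1 (hbd n)
    have h2 := abs_le.1 (hbd (n + 1))
    have h3 := dyadicIdx_succ_div_two n t
    have hk := dyadicIdx_lt (n := n) ht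
    rcases Nat.mod_two_eq_zero_or_one (dyadicIdx (n + 1) t) with h | h
    · rw [show dyadicIdx (n + 1) t = 2 * dyadicIdx n t by omega, hA.left hk] at h2
      exact abs_le.2 ⟨by linarith, by linarith⟩
    · rw [show dyadicIdx (n + 1) t = 2 * dyadicIdx n t + 1 by omega, hA.right hk] at h2
      exact abs_le.2 ⟨by linarith, by linarith⟩
  refine (ENNReal.summable_toReal (hfin M).ne).congr fun n => ?_
  rw [htrunc, ENNReal.toReal_ofReal (sq_nonneg _)]

lemma tsum_haarCoeff_sq_eq {f : ℝ → ℝ} (hf : IntegrableOn f (Icc 0 1)) {t : ℝ}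
    (ht : t ∈ Ico (0 : ℝ) 1) (ht' : ∀ n k : ℕ, t ≠ (k : ℝ) / 2 ^ n) :
    ∑' p : ℕ × ℕ, haarCoeff f p.1 p.2 ^ 2 * (dyadicI p.1 p.2).indicator 1 t =
      ∑' n, halfDiff (dyadicAvg f) n (dyadicIdx n t) ^ 2 := by
  have hmem (n k : ℕ) : t ∈ dyadicI n k ↔ dyadicIdx n t = k := by
    rw [dyadicIdx_eq_iff ht.1, dyadicI]
    refine ⟨fun h => ⟨h.1, lt_of_le_of_ne h.2 ?_⟩, fun h => Ico_subset_Icc_self h⟩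
    have := ht' n (k + 1)
    push_cast at this
    exact this
  have hinj : Function.Injective fun n : ℕ => (n, dyadicIdx n t) :=
    fun a b h => congrArg Prod.fst h
  rw [← hinj.tsum_eq]
  · refine tsum_congr fun n => ?_
    simp only
    rw [indicator_of_mem ((hmem _ _).2 rfl), haarCoeff_eq_halfDiff hf (dyadicIdx_lt ht),
      Pi.one_apply, mul_one]
  · rintro ⟨n, k⟩ h
    refine ⟨n, Prod.ext rfl ?_⟩
    by_contra hne
    exact h (by simp [indicator_of_notMem (mt (hmem n k).1 hne)])

lemma ae_ne_dyadic : ∀ᵐ t : ℝ, ∀ n k : ℕ, t ≠ (k : ℝ) / 2 ^ n := by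
  refine ae_all_iff.2 fun n => ae_all_iff.2 fun k => ?_
  exact Measure.ae_ne volume _

lemma restrict_Ico_eq_Icc :
    (volume : Measure ℝ).restrict (Ico (0 : ℝ) 1) = volume.restrict (Icc (0 : ℝ) 1) :=
  Measure.restrict_congr_set Ico_ae_eq_Icc

lemma ae_sqFn_eq {f : ℝ → ℝ} (hf : IntegrableOn f (Icc 0 1)) :
    ∀ᵐ t ∂volume.restrict (Ico (0 : ℝ) 1),
      sqFn f t = √(∑' n, halfDiff (dyadicAvg f) n (dyadicIdx n t) ^ 2) := by
  filter_upwards [ae_restrict_mem measurableSet_Ico, ae_restrict_of_ae ae_ne_dyadic]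
    with t ht ht'
  rw [sqFn, tsum_haarCoeff_sq_eq hf ht ht']

lemma exists_dyadicIdx_eq_of_ae {p : ℝ → Prop}
    (hp : ∀ᵐ t ∂volume.restrict (Ico (0 : ℝ) 1), p t) {n k : ℕ} (hk : k < 2 ^ n) :
    ∃ t, p t ∧ dyadicIdx n t = k := by
  have hsub : Ico ((k : ℝ) / 2 ^ n) (((k : ℝ) + 1) / 2 ^ n) ⊆ Ico 0 1 :=
    Ico_subset_Ico (dyadic_left_nonneg n k) (dyadic_right_le_one hk)
  have h : ∀ᵐ t ∂volume.restrict (Ico ((k : ℝ) / 2 ^ n) (((k : ℝ) + 1) / 2 ^ n)),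
      p t ∧ dyadicIdx n t = k := by
    filter_upwards [ae_restrict_of_ae_restrict_of_subset hsub hp,
      ae_restrict_mem measurableSet_Ico] with t h1 h2
    exact ⟨h1, (dyadicIdx_eq_iff (hsub h2).1).2 h2⟩
  have : NeBot (ae (volume.restrict (Ico ((k : ℝ) / 2 ^ n) (((k : ℝ) + 1) / 2 ^ n)))) := by
    rw [ae_neBot, Ne, Measure.restrict_eq_zero, Real.volume_Ico, ENNReal.ofReal_eq_zero, not_le]
    linarith [dyadic_lt n k]
  exact h.exists

/-- Admissibility only involves the finite sums of squared Haar coefficients along branches. -/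
lemma admissible_iff {f : ℝ → ℝ} : Admissible f ↔ IntegrableOn f (Icc 0 1) ∧
    (∫ x in Icc (0 : ℝ) 1, f x) = 0 ∧
      ∀ n k, k < 2 ^ n → ancestorSq (dyadicAvg f) n k ≤ 1 := by
  refine and_congr_right fun hf => and_congr_right fun _ => ?_
  rw [← restrict_Ico_eq_Icc]
  constructor
  · intro h n k hk
    obtain ⟨t, ⟨h1, h2, h3⟩, rfl⟩ := exists_dyadicIdx_eq_of_ae
      (h.and ((ae_sqFn_eq hf).and (ae_summable_halfDiff_sq hf))) hk
    rw [h2, Real.sqrt_le_iff] at h1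
    rw [ancestorSq_dyadicIdx]
    exact (h3.sum_le_tsum _ fun _ _ => sq_nonneg _).trans (by simpa using h1.2)
  · intro h
    filter_upwards [ae_sqFn_eq hf, ae_restrict_mem measurableSet_Ico] with t h1 ht
    rw [h1, Real.sqrt_le_iff, one_pow]
    refine ⟨zero_le_one, ?_⟩
    refine Real.tsum_le_of_sum_range_le (fun _ => sq_nonneg _) fun n => ?_
    rw [← ancestorSq_dyadicIdx]
    exact h n _ (dyadicIdx_lt ht)

lemma halfDiff_const_mul (c : ℝ) (A : ℕ → ℕ → ℝ) (n k : ℕ) :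
    halfDiff (fun n k => c * A n k) n k = c * halfDiff A n k := by
  simp only [halfDiff]; ring

lemma ancestorSq_const_mul (c : ℝ) (A : ℕ → ℕ → ℝ) (n k : ℕ) :
    ancestorSq (fun n k => c * A n k) n k = c ^ 2 * ancestorSq A n k := by
  induction n generalizing k with
  | zero => simp [ancestorSq]
  | succ n ih => simp only [ancestorSq, ih, halfDiff_const_mul]; ring

lemma Supersolution.card_le_of_scale {B : ℝ → ℝ} (hB : Supersolution B) {f : ℝ → ℝ}
    (hf : Admissible f) {c : ℝ} (hc : c ∈ Ioo (0 : ℝ) 1) (x : ℝ) (n : ℕ) :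
    ∑ k ∈ Finset.range (2 ^ n), (if x ≤ dyadicAvg f n k then (1 : ℝ) else 0) ≤
      2 ^ n * B (c * x) := by
  obtain ⟨hf1, hf2, hf3⟩ := admissible_iff.1 hf
  have hA := dyadicMartingale_dyadicAvg hf1
  have hcA : DyadicMartingale fun n k => c * dyadicAvg f n k := fun n k hk => by
    simp only; rw [hA n k hk]; ring
  have h := hB.sum_le hcA (fun n k hk => by
    rw [ancestorSq_const_mul]
    nlinarith [hf3 n k hk, ancestorSq_nonneg (dyadicAvg f) n k, hc.1, hc.2]) (c * x) n
  rw [dyadicAvg_zero f, hf2, mul_zero, sub_zero] at h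
  refine le_trans (Finset.sum_le_sum fun k _ => ?_) h
  split_ifs with hx
  · refine (hB.2.2.2.1 _ (div_nonpos_of_nonpos_of_nonneg ?_ (Real.sqrt_nonneg _))).ge
    nlinarith [hc.1]
  · exact hB.2.1 _

lemma Supersolution.lintegral_dyadicAvg_le {B : ℝ → ℝ} (hB : Supersolution B) {f : ℝ → ℝ}
    (hf : Admissible f) (x : ℝ) (n : ℕ) :
    ∫⁻ t in Ico (0 : ℝ) 1, (if x ≤ dyadicAvg f n (dyadicIdx n t) then 1 else 0) ≤
      ENNReal.ofReal (B x) := by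
  have hlim : Tendsto (fun c : ℝ => 2 ^ n * B (c * x)) (𝓝[<] 1) (𝓝 (2 ^ n * B (1 * x))) := by
    have : Continuous fun c : ℝ => 2 ^ n * B (c * x) :=
      continuous_const.mul (hB.1.comp (continuous_id.mul continuous_const))
    exact (this.tendsto 1).mono_left nhdsWithin_le_nhds
  have h := ge_of_tendsto hlim (by
    filter_upwards [Ioo_mem_nhdsLT (zero_lt_one (α := ℝ))] with c hc
    exact hB.card_le_of_scale hf hc x n)
  rw [one_mul] at h
  have hsum := lintegral_dyadicIdx n fun k =>
    ENNReal.ofReal (if x ≤ dyadicAvg f n k then 1 else 0)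
  rw [← ENNReal.ofReal_sum_of_nonneg fun k _ => by split_ifs <;> norm_num,
    ← ENNReal.ofReal_mul (by positivity)] at hsum
  refine le_trans (le_of_eq ?_) (hsum.trans_le (ENNReal.ofReal_le_ofReal ?_))
  · refine lintegral_congr fun t => ?_
    split_ifs <;> simp
  · rw [inv_mul_le_iff₀ (by positivity)]; exact h

lemma Supersolution.volume_le {B : ℝ → ℝ} (hB : Supersolution B) {f : ℝ → ℝ}
    (hf : Admissible f) (x : ℝ) :
    volume {y ∈ Icc (0 : ℝ) 1 | x ≤ f y} ≤ ENNReal.ofReal (B x) := by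
  have key (ε : ℝ) (hε : 0 < ε) :
      volume {y ∈ Icc (0 : ℝ) 1 | x ≤ f y} ≤ ENNReal.ofReal (B (x - ε)) := by
    let G : ℕ → ℝ → ENNReal := fun n t =>
      if x - ε ≤ dyadicAvg f n (dyadicIdx n t) then 1 else 0
    have hmeas (n : ℕ) : Measurable (G n) :=
      (measurable_from_nat (f := fun k => if x - ε ≤ dyadicAvg f n k then (1 : ENNReal)
        else 0)).comp (measurable_dyadicIdx n)
    calc volume {y ∈ Icc (0 : ℝ) 1 | x ≤ f y}
        = volume ({y | x ≤ f y} ∩ Icc (0 : ℝ) 1) := by rw [inter_comm]; rfl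
      _ = volume.restrict (Ico (0 : ℝ) 1) {y | x ≤ f y} := by
        rw [restrict_Ico_eq_Icc, Measure.restrict_apply' measurableSet_Icc]
      _ ≤ volume.restrict (Ico (0 : ℝ) 1) {y | 1 ≤ liminf (fun n => G n y) atTop} := by
        refine measure_mono_ae ?_
        filter_upwards [ae_tendsto_dyadicAvg hf.1] with t ht (hxt : x ≤ f t)
        refine le_liminf_of_le (by isBoundedDefault) ?_
        filter_upwards [ht.eventually_const_le (show x - ε < f t by linarith)] with n hn
        exact (if_pos hn).ge
      _ ≤ ∫⁻ t in Ico (0 : ℝ) 1, liminf (fun n => G n t) atTop :=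
        meas_le_lintegral₀ (Measurable.liminf hmeas).aemeasurable fun _ h => h
      _ ≤ liminf (fun n => ∫⁻ t in Ico (0 : ℝ) 1, G n t) atTop :=
        lintegral_liminf_le hmeas
      _ ≤ ENNReal.ofReal (B (x - ε)) :=
        liminf_le_of_le (by isBoundedDefault) fun b hb => by
          obtain ⟨n, hn⟩ := hb.exists
          exact hn.trans (hB.lintegral_dyadicAvg_le hf _ n)
  have hlim : Tendsto (fun ε : ℝ => ENNReal.ofReal (B (x - ε))) (𝓝[>] 0)
      (𝓝 (ENNReal.ofReal (B (x - 0)))) := by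
    have : Continuous fun ε : ℝ => ENNReal.ofReal (B (x - ε)) :=
      ENNReal.continuous_ofReal.comp (hB.1.comp (continuous_const.sub continuous_id))
    exact (this.tendsto 0).mono_left nhdsWithin_le_nhds
  rw [sub_zero] at hlim
  exact ge_of_tendsto hlim (eventually_mem_nhdsWithin.mono key)

lemma admissible_zero : Admissible fun _ => 0 := by
  refine admissible_iff.2 ⟨integrableOn_zero, by simp, fun n k _ => ?_⟩
  have h (n k : ℕ) : ancestorSq (dyadicAvg fun _ => 0) n k = 0 := by
    induction n generalizing k with
    | zero => rfl
    | succ n ih => simp [ancestorSq, ih, halfDiff, dyadicAvg]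
  rw [h]; exact zero_le_one

lemma Supersolution.bellman_le {B : ℝ → ℝ} (hB : Supersolution B) (x : ℝ) :
    bellman x ≤ B x := by
  refine csSup_le ⟨_, _, admissible_zero, rfl⟩ ?_
  rintro m ⟨f, hf, rfl⟩
  exact ENNReal.toReal_le_of_le_ofReal (hB.2.1 x) (hB.volume_le hf x)

lemma volume_superlevel_le_one (f : ℝ → ℝ) (x : ℝ) :
    volume {y ∈ Icc (0 : ℝ) 1 | x ≤ f y} ≤ 1 :=
  (measure_mono (sep_subset _ _)).trans (by simp)

lemma volume_superlevel_ne_top (f : ℝ → ℝ) (x : ℝ) :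
    volume {y ∈ Icc (0 : ℝ) 1 | x ≤ f y} ≠ ⊤ :=
  ((volume_superlevel_le_one f x).trans_lt ENNReal.one_lt_top).ne

lemma le_bellman {f : ℝ → ℝ} (hf : Admissible f) (x : ℝ) :
    (volume {y ∈ Icc (0 : ℝ) 1 | x ≤ f y}).toReal ≤ bellman x := by
  refine le_csSup ⟨1, ?_⟩ ⟨f, hf, rfl⟩
  rintro m ⟨g, -, rfl⟩
  exact ENNReal.toReal_le_of_le_ofReal zero_le_one (by simpa using volume_superlevel_le_one g x)

lemma bellman_le_of_forall {x b : ℝ}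
    (h : ∀ f, Admissible f → (volume {y ∈ Icc (0 : ℝ) 1 | x ≤ f y}).toReal ≤ b) :
    bellman x ≤ b := by
  refine csSup_le ⟨_, _, admissible_zero, rfl⟩ ?_
  rintro m ⟨f, hf, rfl⟩
  exact h f hf

lemma bellman_nonneg (x : ℝ) : 0 ≤ bellman x :=
  ENNReal.toReal_nonneg.trans (le_bellman admissible_zero x)

lemma bellman_antitone : Antitone bellman := fun x _ hxy =>
  bellman_le_of_forall fun f hf => (ENNReal.toReal_mono (volume_superlevel_ne_top f x)
    (measure_mono fun _ h => ⟨h.1, hxy.trans h.2⟩)).trans (le_bellman hf x)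

lemma bellman_eq_one {x : ℝ} (hx : x ≤ 0) : bellman x = 1 := by
  refine le_antisymm (bellman_le_of_forall fun f _ =>
    ENNReal.toReal_le_of_le_ofReal zero_le_one (by simpa using volume_superlevel_le_one f x)) ?_
  have h := le_bellman admissible_zero x
  rw [show {y ∈ Icc (0 : ℝ) 1 | x ≤ 0} = Icc 0 1 from sep_eq_self_iff_mem_true.2 fun _ _ => hx,
    Real.volume_Icc] at h
  simpa using h

lemma sqrt_one_sub_sq_mem {t : ℝ} (ht : t ^ 2 ≤ 1) : √(1 - t ^ 2) ∈ Icc (1 - t ^ 2) 1 := by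
  refine ⟨Real.le_sqrt_of_sq_le (by nlinarith [sq_nonneg t]), Real.sqrt_le_one.2 ?_⟩
  nlinarith [sq_nonneg t]

lemma XX_shift_bounds (x : ℝ) {t : ℝ} (h0 : 0 < t) (h1 : t < 1) (hx : |x| * t < 1 / 2) :
    XX (x + t / 2) (-t) < x ∧ x < XX (x + t / 2) t := by
  obtain ⟨hl, hu⟩ := sqrt_one_sub_sq_mem (t := t) (by nlinarith)
  have hpos : 0 < √(1 - t ^ 2) := Real.sqrt_pos.2 (by nlinarith)
  have hx1 := neg_abs_le x
  have hx2 := le_abs_self x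
  have hprod : |x| * (1 - √(1 - t ^ 2)) ≤ |x| * t ^ 2 :=
    mul_le_mul_of_nonneg_left (by linarith) (abs_nonneg x)
  have hprod' : |x| * t ^ 2 < t / 2 := by nlinarith
  constructor
  · rw [XX, neg_sq, div_lt_iff₀ hpos]
    nlinarith
  · rw [XX, lt_div_iff₀ hpos]
    nlinarith

/-- A nonincreasing function that satisfies the Bellman inequality is continuous. -/
lemma Antitone.continuous_of_midpoint_XX_le {B : ℝ → ℝ} (hB : Antitone B)
    (h : ∀ x : ℝ, ∀ τ ∈ Ioo (-1 : ℝ) 1, (B (XX x (-τ)) + B (XX x τ)) / 2 ≤ B x) :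
    Continuous B := by
  refine continuous_iff_continuousAt.2 fun x => ?_
  rw [hB.continuousAt_iff_leftLim_eq_rightLim]
  refine le_antisymm ?_ (hB.rightLim_le_leftLim le_rfl)
  have hsqrt : Tendsto (fun t : ℝ => XX (x + t / 2) t) (𝓝[>] 0) (𝓝 x) := by
    have : ContinuousAt (fun t : ℝ => XX (x + t / 2) t) 0 := by
      unfold XX
      exact ContinuousAt.div (by fun_prop) (by fun_prop) (by simp)
    simpa [XX] using this.tendsto.mono_left nhdsWithin_le_nhds
  have hsmall : ∀ᶠ t : ℝ in 𝓝[>] 0, 0 < t ∧ t < 1 ∧ |x| * t < 1 / 2 := by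
    have h1 : ∀ᶠ t : ℝ in 𝓝 0, |x| * t < 1 / 2 :=
      (by fun_prop : Continuous fun t : ℝ => |x| * t).continuousAt.eventually_lt_const
        (by simp)
    filter_upwards [Ioo_mem_nhdsGT (zero_lt_one (α := ℝ)), nhdsWithin_le_nhds h1] with t h2 h3
    exact ⟨h2.1, h2.2, h3⟩
  have hR1 : Tendsto (fun t : ℝ => B (x + t / 2)) (𝓝[>] 0) (𝓝 (Function.rightLim B x)) := by
    refine (hB.tendsto_rightLim x).comp (tendsto_nhdsWithin_iff.2 ⟨?_, ?_⟩)
    · have : Continuous fun t : ℝ => x + t / 2 := by fun_prop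
      simpa using (this.tendsto 0).mono_left nhdsWithin_le_nhds
    · filter_upwards [hsmall] with t ht
      simpa using ht.1
  have hR2 : Tendsto (fun t : ℝ => B (XX (x + t / 2) t)) (𝓝[>] 0)
      (𝓝 (Function.rightLim B x)) := by
    refine (hB.tendsto_rightLim x).comp (tendsto_nhdsWithin_iff.2 ⟨hsqrt, ?_⟩)
    filter_upwards [hsmall] with t ht
    exact (XX_shift_bounds x ht.1 ht.2.1 ht.2.2).2
  have hle := le_of_tendsto_of_tendsto
    ((tendsto_const_nhds (x := Function.leftLim B x)).add hR2 |>.div_const 2) hR1 (by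
      filter_upwards [hsmall] with t ht
      have h1 := hB.leftLim_le (XX_shift_bounds x ht.1 ht.2.1 ht.2.2).1
      have h2 := h (x + t / 2) t ⟨by linarith [ht.1], ht.2.1⟩
      linarith)
  linarith

lemma half_dyadic_bounds {ε n k : ℕ} (hk : k < 2 ^ n) :
    (ε : ℝ) / 2 ≤ ((ε * 2 ^ n + k : ℕ) : ℝ) / 2 ^ (n + 1) ∧
      (((ε * 2 ^ n + k : ℕ) : ℝ) + 1) / 2 ^ (n + 1) ≤ (1 + ε) / 2 := by
  have hk' : (k : ℝ) + 1 ≤ 2 ^ n := by exact_mod_cast hk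
  have h2 : (0 : ℝ) < 2 ^ n := by positivity
  rw [pow_succ, div_le_div_iff₀ (by positivity) (by positivity),
    div_le_div_iff₀ (by positivity) (by positivity)]
  push_cast
  constructor <;> nlinarith [Nat.cast_nonneg (α := ℝ) k]

lemma intervalIntegrable_comp_half {f : ℝ → ℝ} (hf : IntegrableOn f (Icc 0 1))
    (ε : ℝ) : IntervalIntegrable (fun t => f (2 * t - ε)) volume (ε / 2) ((1 + ε) / 2) := by
  have h := ((intervalIntegrable_of_Icc hf le_rfl zero_le_one le_rfl).comp_sub_right
    ε).comp_mul_left (c := 2)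
  simpa using h

/-- If `h` is an affine image of a rescaled copy of `f` on half of the unit interval, then so are
its dyadic means. -/
lemma dyadicAvg_of_half {f h : ℝ → ℝ} (hf : IntegrableOn f (Icc 0 1)) {ε : ℕ} {σ c : ℝ}
    (hh : ∀ t ∈ Ioc ((ε : ℝ) / 2) ((1 + ε) / 2), h t = σ + c * f (2 * t - ε)) {n k : ℕ}
    (hk : k < 2 ^ n) : dyadicAvg h (n + 1) (ε * 2 ^ n + k) = σ + c * dyadicAvg f n k := by
  obtain ⟨ha, hb⟩ := half_dyadic_bounds (ε := ε) hk
  have hab := dyadic_lt (n + 1) (ε * 2 ^ n + k)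
  have h_int : IntervalIntegrable (fun t => f (2 * t - ε)) volume
      (((ε * 2 ^ n + k : ℕ) : ℝ) / 2 ^ (n + 1))
      ((((ε * 2 ^ n + k : ℕ) : ℝ) + 1) / 2 ^ (n + 1)) := by
    refine (intervalIntegrable_comp_half hf ε).mono_set ?_
    rw [uIcc_of_le hab.le, uIcc_of_le (by linarith)]
    exact Icc_subset_Icc ha hb
  have hcongr : ∫ t in (((ε * 2 ^ n + k : ℕ) : ℝ) / 2 ^ (n + 1))..
      ((((ε * 2 ^ n + k : ℕ) : ℝ) + 1) / 2 ^ (n + 1)), h t =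
      ∫ t in (((ε * 2 ^ n + k : ℕ) : ℝ) / 2 ^ (n + 1))..
      ((((ε * 2 ^ n + k : ℕ) : ℝ) + 1) / 2 ^ (n + 1)), (σ + c * f (2 * t - ε)) := by
    rw [intervalIntegral.integral_of_le hab.le, intervalIntegral.integral_of_le hab.le]
    exact setIntegral_congr_fun measurableSet_Ioc fun t ht => hh t ⟨ha.trans_lt ht.1, ht.2.trans hb⟩
  have e1 : 2 * (((ε * 2 ^ n + k : ℕ) : ℝ) / 2 ^ (n + 1)) - ε = k / 2 ^ n := by
    rw [pow_succ]; push_cast; field_simp; ring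
  have e2 : 2 * ((((ε * 2 ^ n + k : ℕ) : ℝ) + 1) / 2 ^ (n + 1)) - ε = (k + 1) / 2 ^ n := by
    rw [pow_succ]; push_cast; field_simp; ring
  rw [dyadicAvg, hcongr, intervalIntegral.integral_add intervalIntegrable_const
    (h_int.const_mul c), intervalIntegral.integral_const, intervalIntegral.integral_const_mul,
    intervalIntegral.integral_comp_mul_sub _ two_ne_zero, e1, e2, dyadicAvg, ← sub_div,
    add_sub_cancel_left, pow_succ, smul_eq_mul, smul_eq_mul]
  field_simp

lemma ancestorSq_of_half {A A' : ℕ → ℕ → ℝ} {ε : ℕ} (hε : ε < 2) {σ c : ℝ}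
    (hA : ∀ n k, k < 2 ^ n → A (n + 1) (ε * 2 ^ n + k) = σ + c * A' n k) {n k : ℕ}
    (hk : k < 2 ^ n) :
    ancestorSq A (n + 1) (ε * 2 ^ n + k) = halfDiff A 0 0 ^ 2 + c ^ 2 * ancestorSq A' n k := by
  induction n generalizing k with
  | zero =>
    have h : (ε + k) / 2 = 0 := by omega
    simp [ancestorSq, h]
  | succ n ih =>
    have hp : 2 ^ (n + 1) = 2 * 2 ^ n := pow_succ' 2 n
    have hk2 : k / 2 < 2 ^ n := by omega
    have hdiv : (ε * 2 ^ (n + 1) + k) / 2 = ε * 2 ^ n + k / 2 := by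
      rw [hp, mul_left_comm]; omega
    have hd : halfDiff A (n + 1) (ε * 2 ^ n + k / 2) = c * halfDiff A' n (k / 2) := by
      have e0 : 2 * (ε * 2 ^ n + k / 2) = ε * 2 ^ (n + 1) + 2 * (k / 2) := by rw [hp]; ring
      rw [halfDiff, halfDiff, e0, add_assoc (ε * _), hA (n + 1) _ (by omega),
        hA (n + 1) _ (by omega)]
      ring
    rw [ancestorSq, hdiv, ih hk2, hd, ancestorSq]
    ring

/-- The concatenation of rescaled copies of `f` and `g` on the two halves of the unit interval,
with top Haar coefficient `τ`. -/
def haarGlue (τ : ℝ) (f g : ℝ → ℝ) (t : ℝ) : ℝ :=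
  if t ≤ 1 / 2 then -τ + √(1 - τ ^ 2) * f (2 * t) else τ + √(1 - τ ^ 2) * g (2 * t - 1)

lemma haarGlue_left (τ : ℝ) (f g : ℝ → ℝ) {t : ℝ} (ht : t ≤ 1 / 2) :
    haarGlue τ f g t = -τ + √(1 - τ ^ 2) * f (2 * t) := if_pos ht

lemma haarGlue_right (τ : ℝ) (f g : ℝ → ℝ) {t : ℝ} (ht : 1 / 2 < t) :
    haarGlue τ f g t = τ + √(1 - τ ^ 2) * g (2 * t - 1) := if_neg (not_le.2 ht)

lemma integrableOn_haarGlue (τ : ℝ) {f g : ℝ → ℝ} (hf : IntegrableOn f (Icc 0 1))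
    (hg : IntegrableOn g (Icc 0 1)) : IntegrableOn (haarGlue τ f g) (Icc 0 1) := by
  rw [← intervalIntegrable_iff_integrableOn_Icc_of_le zero_le_one]
  refine IntervalIntegrable.trans (b := 1 / 2) ?_ ?_
  · have h := (intervalIntegrable_const (c := (-τ))).add
      ((intervalIntegrable_comp_half hf 0).const_mul (√(1 - τ ^ 2)))
    norm_num at h
    refine h.congr fun t ht => ?_
    rw [uIoc_of_le (by norm_num)] at ht
    exact (haarGlue_left τ f g ht.2).symm
  · have h := (intervalIntegrable_const (c := τ)).add
      ((intervalIntegrable_comp_half hg 1).const_mul (√(1 - τ ^ 2)))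
    norm_num at h
    refine h.congr fun t ht => ?_
    rw [uIoc_of_le (by norm_num)] at ht
    exact (haarGlue_right τ f g ht.1).symm

lemma admissible_haarGlue {τ : ℝ} (hτ : τ ∈ Ioo (-1 : ℝ) 1) {f g : ℝ → ℝ} (hf : Admissible f)
    (hg : Admissible g) : Admissible (haarGlue τ f g) := by
  obtain ⟨hf1, hf2, hf3⟩ := admissible_iff.1 hf
  obtain ⟨hg1, hg2, hg3⟩ := admissible_iff.1 hg
  have hτ2 : τ ^ 2 ≤ 1 := by nlinarith [hτ.1, hτ.2]
  have hc : √(1 - τ ^ 2) ^ 2 = 1 - τ ^ 2 := Real.sq_sqrt (by linarith)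
  have h_int := integrableOn_haarGlue τ hf1 hg1
  have hL (n k : ℕ) (hk : k < 2 ^ n) : dyadicAvg (haarGlue τ f g) (n + 1) (0 * 2 ^ n + k) =
      -τ + √(1 - τ ^ 2) * dyadicAvg f n k :=
    dyadicAvg_of_half hf1 (fun t ht => by
      rw [haarGlue_left τ f g (by simpa using ht.2)]; simp) hk
  have hR (n k : ℕ) (hk : k < 2 ^ n) : dyadicAvg (haarGlue τ f g) (n + 1) (1 * 2 ^ n + k) =
      τ + √(1 - τ ^ 2) * dyadicAvg g n k :=
    dyadicAvg_of_half hg1 (fun t ht => by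
      rw [haarGlue_right τ f g (by simpa using ht.1)]; simp) hk
  have hL0 := hL 0 0 (by norm_num)
  have hR0 := hR 0 0 (by norm_num)
  rw [dyadicAvg_zero _, hf2] at hL0
  rw [dyadicAvg_zero _, hg2] at hR0
  norm_num at hL0 hR0
  have htop : halfDiff (dyadicAvg (haarGlue τ f g)) 0 0 = τ := by
    rw [halfDiff]; norm_num [hL0, hR0]
  refine admissible_iff.2 ⟨h_int, ?_, fun n k hk => ?_⟩
  · rw [← dyadicAvg_zero _, dyadicMartingale_dyadicAvg h_int 0 0 (by norm_num)]
    norm_num [hL0, hR0]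
  · cases n with
    | zero => simp [ancestorSq]
    | succ n =>
      rcases lt_or_ge k (2 ^ n) with h | h
      · have := ancestorSq_of_half (by norm_num) hL h
        rw [zero_mul, zero_add, htop, hc] at this
        rw [this]
        nlinarith [hf3 n k h]
      · obtain ⟨j, rfl⟩ := Nat.exists_eq_add_of_le h
        have hj : j < 2 ^ n := by rw [pow_succ] at hk; omega
        have := ancestorSq_of_half (by norm_num) hR hj
        rw [one_mul, htop, hc] at this
        rw [this]
        nlinarith [hg3 n j hj]

lemma volume_preimage_two_mul_sub (ε : ℝ) (s : Set ℝ) :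
    volume ((fun t : ℝ => 2 * t - ε) ⁻¹' s) = ENNReal.ofReal (1 / 2) * volume s := by
  have h : (fun t : ℝ => 2 * t - ε) ⁻¹' s = (fun t : ℝ => 2 * t) ⁻¹' ((fun t => t + -ε) ⁻¹' s) :=
    rfl
  rw [h, Real.volume_preimage_mul_left two_ne_zero, measure_preimage_add_right, one_div,
    abs_of_pos (by positivity)]

lemma volume_superlevel_haarGlue_ge {τ : ℝ} (hτ : τ ∈ Ioo (-1 : ℝ) 1) (f g : ℝ → ℝ) (x : ℝ) :
    ((volume {y ∈ Icc (0 : ℝ) 1 | XX x (-τ) ≤ g y}).toReal +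
      (volume {y ∈ Icc (0 : ℝ) 1 | XX x τ ≤ f y}).toReal) / 2 ≤
      (volume {y ∈ Icc (0 : ℝ) 1 | x ≤ haarGlue τ f g y}).toReal := by
  have hc : 0 < √(1 - τ ^ 2) := Real.sqrt_pos.2 (by nlinarith [hτ.1, hτ.2])
  set E := {y ∈ Icc (0 : ℝ) 1 | x ≤ haarGlue τ f g y}
  have hL : volume ((fun t : ℝ => 2 * t - 0) ⁻¹' {y ∈ Icc (0 : ℝ) 1 | XX x τ ≤ f y}) ≤
      volume (E ∩ Iic (1 / 2)) := by
    refine measure_mono ?_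
    rintro t ⟨⟨h0, h1⟩, h2⟩
    simp only [sub_zero, XX, div_le_iff₀ hc] at h0 h1 h2
    have ht : t ≤ 1 / 2 := by linarith
    refine ⟨⟨⟨by linarith, by linarith⟩, ?_⟩, ht⟩
    rw [haarGlue_left τ f g ht]
    linarith
  have hR : volume ((fun t : ℝ => 2 * t - 1) ⁻¹' {y ∈ Icc (0 : ℝ) 1 | XX x (-τ) ≤ g y}) ≤
      volume (E \ Iic (1 / 2)) := by
    refine measure_mono_ae ?_
    filter_upwards [Measure.ae_ne volume (1 / 2 : ℝ)] with t hne
    rintro ⟨⟨h0, h1⟩, h2⟩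
    simp only [XX, neg_sq, div_le_iff₀ hc] at h0 h1 h2
    have ht : 1 / 2 < t := lt_of_le_of_ne (by linarith) hne.symm
    refine ⟨⟨⟨by linarith, by linarith⟩, ?_⟩, not_le.2 ht⟩
    rw [haarGlue_right τ f g ht]
    linarith
  rw [volume_preimage_two_mul_sub] at hL hR
  have hsum : ENNReal.ofReal (1 / 2) * volume {y ∈ Icc (0 : ℝ) 1 | XX x τ ≤ f y} +
      ENNReal.ofReal (1 / 2) * volume {y ∈ Icc (0 : ℝ) 1 | XX x (-τ) ≤ g y} ≤ volume E :=
    (add_le_add hL hR).trans_eq (measure_inter_add_sdiff E measurableSet_Iic)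
  have h := ENNReal.toReal_mono (volume_superlevel_ne_top _ _) hsum
  rw [ENNReal.toReal_add (ENNReal.mul_ne_top ENNReal.ofReal_ne_top (volume_superlevel_ne_top _ _))
    (ENNReal.mul_ne_top ENNReal.ofReal_ne_top (volume_superlevel_ne_top _ _)),
    ENNReal.toReal_mul, ENNReal.toReal_mul, ENNReal.toReal_ofReal (by norm_num)] at h
  linarith

lemma bellman_midpoint_le (x : ℝ) {τ : ℝ} (hτ : τ ∈ Ioo (-1 : ℝ) 1) :
    (bellman (XX x (-τ)) + bellman (XX x τ)) / 2 ≤ bellman x := by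
  have h1 : bellman (XX x (-τ)) ≤ 2 * bellman x - bellman (XX x τ) := by
    refine bellman_le_of_forall fun g hg => ?_
    have h2 : bellman (XX x τ) ≤
        2 * bellman x - (volume {y ∈ Icc (0 : ℝ) 1 | XX x (-τ) ≤ g y}).toReal :=
      bellman_le_of_forall fun f hf => by
        linarith [(volume_superlevel_haarGlue_ge hτ f g x).trans
          (le_bellman (admissible_haarGlue hτ hf hg) x)]
    linarith
  linarith

lemma supersolution_bellman : Supersolution bellman :=
  ⟨bellman_antitone.continuous_of_midpoint_XX_le fun x _ hτ => bellman_midpoint_le x hτ,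
    bellman_nonneg, bellman_antitone, fun _ hx => bellman_eq_one hx,
    fun x _ hτ => bellman_midpoint_le x hτ⟩

theorem bellman_least_supersolution :
    Supersolution bellman ∧ ∀ B : ℝ → ℝ, Supersolution B → ∀ x : ℝ, bellman x ≤ B x := by
  exact ⟨supersolution_bellman, fun _ hB => hB.bellman_le⟩
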